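/- Let n ≥ 2, −n < p < 0 and 1 < q < n + 1. Let f : S^{n-1} → ℝ be continuous, positive and even, and let c₀ > 0, C* > 0. Then there exists a constant C ≥ 1, depending only on n, p, q, f, c₀, C*, such that every origin-symmetric convex body Ω ⊂ ℝⁿ satisfying I_q(Ω) ≥ c₀ and ∫_{S^{n-1}} f(x)·h_Ω(x)^p dH^{n-1}(x) ≥ C* satisfies 1/C ≤ h_Ω(x) ≤ C for all x ∈ S^{n-1}. -/

import Mathlib

open MeasureTheory Metric
open scoped RealInnerProductSpace

/-- `ω_n`, the volume of the unit ball of `ℝⁿ`. -/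
noncomputable def unitBallVol (n : ℕ) : ℝ :=
  (volume (closedBall (0 : EuclideanSpace ℝ (Fin n)) 1)).toReal

/-- The chord integral `I_q(Ω)` for `q > 1`. -/
noncomputable def chordIntegral (n : ℕ) (q : ℝ) (Ω : Set (EuclideanSpace ℝ (Fin n))) : ℝ :=
  (q * (q - 1) / ((n : ℝ) * unitBallVol n)) *
    ∫ z in Ω, ∫ y in Ω, ‖y - z‖ ^ (q - 1 - (n : ℝ))

/-- The support function `h_Ω(x) = max {x ⬝ y : y ∈ Ω}`. -/
noncomputable def suppFn {n : ℕ} (Ω : Set (EuclideanSpace ℝ (Fin n)))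
    (x : EuclideanSpace ℝ (Fin n)) : ℝ :=
  sSup ((fun y => ⟪x, y⟫) '' Ω)

section


open Filter Topology Set
open scoped ENNReal NNReal

/-- A separated subset of a sublevel set on the sphere has cardinality controlled by the volume of
the sublevel set in a ball. -/
lemma card_separated_sphere_le {n : ℕ} {g : EuclideanSpace ℝ (Fin n) → ℝ} {B s r : ℝ}
    (hhom : ∀ t : ℝ, 0 ≤ t → ∀ x, g (t • x) = t * g x)
    (hlip : ∀ x y, g y ≤ g x + B * ‖y - x‖)
    (hB : 0 ≤ B) (hs : 0 < s) (hr : 0 < r) (hr1 : r ≤ 1) (hrB : B * r ≤ 2 * s)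
    (C : Finset (EuclideanSpace ℝ (Fin n)))
    (hC : ∀ x ∈ C, ‖x‖ = 1 ∧ g x < s)
    (hsep : ∀ x ∈ C, ∀ y ∈ C, x ≠ y → r < dist x y) :
    (C.card : ℝ≥0∞) * ENNReal.ofReal r⁻¹ * (ENNReal.ofReal ((r / 2) ^ n) *
      volume (ball (0 : EuclideanSpace ℝ (Fin n)) 1)) ≤
      volume {y : EuclideanSpace ℝ (Fin n) | ‖y‖ ≤ 3 ∧ g y ≤ 3 * s} := by
  classical
  set m : ℕ := ⌊r⁻¹⌋₊
  have hmr : r⁻¹ ≤ (m + 1 : ℕ) := by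
    push_cast
    exact (Nat.lt_floor_add_one _).le
  have hjr : ∀ j ∈ Finset.range (m + 1), (j : ℝ) * r ≤ 1 := by
    intro j hj
    have h1 : (j : ℝ) ≤ m := by
      exact_mod_cast Nat.lt_succ_iff.1 (Finset.mem_range.1 hj)
    have h2 : (m : ℝ) ≤ r⁻¹ := Nat.floor_le (by positivity)
    calc (j : ℝ) * r ≤ r⁻¹ * r := by gcongr; linarith
      _ = 1 := inv_mul_cancel₀ hr.ne'
  let I := C ×ˢ Finset.range (m + 1)
  let c : EuclideanSpace ℝ (Fin n) × ℕ → EuclideanSpace ℝ (Fin n) := fun a => (1 + a.2 * r) • a.1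
  have hcdist : ∀ a ∈ I, ∀ b ∈ I, a ≠ b → r ≤ dist (c a) (c b) := by
    rintro ⟨x, j⟩ ha ⟨y, k⟩ hb hab
    simp only [I, Finset.mem_product] at ha hb
    have hx := (hC x ha.1).1
    have hy := (hC y hb.1).1
    simp only [c]
    by_cases hjk : j = k
    · subst hjk
      have hxy : x ≠ y := fun h => hab (by rw [h])
      rw [dist_eq_norm, ← smul_sub, norm_smul, ← dist_eq_norm, Real.norm_of_nonneg (by positivity)]
      have := hsep x ha.1 y hb.1 hxy
      have h0 : (0 : ℝ) ≤ j * r := by positivity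
      nlinarith
    · rw [dist_eq_norm]
      have h1 := abs_norm_sub_norm_le ((1 + (j : ℝ) * r) • x) ((1 + (k : ℝ) * r) • y)
      rw [norm_smul, norm_smul, hx, hy, Real.norm_of_nonneg (by positivity),
        Real.norm_of_nonneg (by positivity)] at h1
      refine le_trans ?_ h1
      have h2 : (1 : ℝ) ≤ |(j : ℝ) - k| := by
        have : (1 : ℤ) ≤ |(j : ℤ) - k| := Int.one_le_abs (sub_ne_zero.2 (by exact_mod_cast hjk))
        exact_mod_cast this
      have h3 : (1 + (j : ℝ) * r) * 1 - (1 + (k : ℝ) * r) * 1 = ((j : ℝ) - k) * r := by ring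
      rw [h3, abs_mul, abs_of_pos hr]
      nlinarith
  have hdisj : (I : Set (EuclideanSpace ℝ (Fin n) × ℕ)).PairwiseDisjoint
      (fun a => ball (c a) (r / 2)) := by
    intro a ha b hb hab
    apply ball_disjoint_ball
    have := hcdist a ha b hb hab
    linarith
  have hsub : (⋃ a ∈ I, ball (c a) (r / 2)) ⊆
      {y : EuclideanSpace ℝ (Fin n) | ‖y‖ ≤ 3 ∧ g y ≤ 3 * s} := by
    intro y hy
    simp only [mem_iUnion, exists_prop] at hy
    obtain ⟨⟨x, j⟩, ha, hy⟩ := hy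
    simp only [I, Finset.mem_product] at ha
    have hx := hC x ha.1
    have hj := hjr j ha.2
    have hj0 : (0 : ℝ) ≤ j * r := by positivity
    rw [mem_ball, dist_eq_norm] at hy
    have hcn : ‖c (x, j)‖ = 1 + j * r := by
      simp only [c]
      rw [norm_smul, hx.1, Real.norm_of_nonneg (by positivity), mul_one]
    constructor
    · have := norm_le_norm_add_norm_sub' y (c (x, j))
      rw [hcn] at this
      linarith
    · have h1 := hlip (c (x, j)) y
      have h2 : g (c (x, j)) = (1 + j * r) * g x := hhom _ (by positivity) _
      have h3 : B * ‖y - c (x, j)‖ ≤ B * (r / 2) := by gcongr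
      have h4 : (1 + j * r) * g x ≤ (1 + j * r) * s := by
        gcongr
        exact hx.2.le
      nlinarith
  calc (C.card : ℝ≥0∞) * ENNReal.ofReal r⁻¹ * (ENNReal.ofReal ((r / 2) ^ n) *
        volume (ball (0 : EuclideanSpace ℝ (Fin n)) 1))
      ≤ (C.card : ℝ≥0∞) * ((m + 1 : ℕ) : ℝ≥0∞) * (ENNReal.ofReal ((r / 2) ^ n) *
        volume (ball (0 : EuclideanSpace ℝ (Fin n)) 1)) := by
        gcongr
        rw [← ENNReal.ofReal_natCast]
        exact ENNReal.ofReal_le_ofReal hmr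
    _ = ∑ a ∈ I, volume (ball (c a) (r / 2)) := by
        simp_rw [Measure.addHaar_ball_of_pos volume _ (half_pos hr), finrank_euclideanSpace_fin]
        rw [Finset.sum_const, Finset.card_product, Finset.card_range]
        simp [mul_assoc]
    _ = volume (⋃ a ∈ I, ball (c a) (r / 2)) :=
        (measure_biUnion_finset hdisj fun _ _ => measurableSet_ball).symm
    _ ≤ _ := measure_mono hsub

/-- A totally bounded set is covered by balls centred at a finite separated subset. -/
lemma exists_finset_separated_cover {X : Type*} [MetricSpace X] {A : Set X}
    (hA : TotallyBounded A) {r : ℝ} (hr : 0 < r) :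
    ∃ C : Finset X, (∀ x ∈ C, x ∈ A) ∧ (∀ x ∈ C, ∀ y ∈ C, x ≠ y → r < dist x y) ∧
      A ⊆ ⋃ x ∈ C, closedBall x r := by
  lift r to ℝ≥0 using hr.le
  have hr' : 0 < r := hr
  have hfin : packingNumber r A ≠ ⊤ := by
    obtain ⟨N, hN, hNf, hNc⟩ := exists_finite_isCover_of_totallyBounded
      (ε := r / 2) (half_pos hr').ne' hA
    have h1 := packingNumber_two_mul_le_externalCoveringNumber (r / 2) A
    rw [mul_div_cancel₀ r two_ne_zero] at h1
    exact ((h1.trans hNc.externalCoveringNumber_le_encard).trans_lt hNf.encard_lt_top).ne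
  have hCf : (maximalSeparatedSet r A).Finite := by
    rw [← Set.encard_lt_top_iff, encard_maximalSeparatedSet hfin]
    exact lt_top_iff_ne_top.2 hfin
  refine ⟨hCf.toFinset, fun x hx => maximalSeparatedSet_subset (hCf.mem_toFinset.1 hx), ?_, ?_⟩
  · intro x hx y hy hxy
    have : (r : ℝ≥0∞) < edist x y :=
      isSeparated_maximalSeparatedSet (hCf.mem_toFinset.1 hx) (hCf.mem_toFinset.1 hy) hxy
    rw [edist_dist, ENNReal.lt_ofReal_iff_toReal_lt ENNReal.coe_ne_top] at this
    simpa using this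
  · have := isCover_iff_subset_iUnion_closedEBall.1 (isCover_maximalSeparatedSet hfin)
    simpa [closedEBall_coe] using this

/-- The Hausdorff measure of a spherical sublevel set of a positively homogeneous Lipschitz
function is controlled by the volume of a solid sublevel set. -/
lemma hausdorffMeasure_sphere_sublevel_le {n : ℕ} (hn : 1 ≤ n) {g : EuclideanSpace ℝ (Fin n) → ℝ}
    {B s : ℝ} (hhom : ∀ t : ℝ, 0 ≤ t → ∀ x, g (t • x) = t * g x)
    (hlip : ∀ x y, g y ≤ g x + B * ‖y - x‖) (hB : 0 ≤ B) (hs : 0 < s) :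
    μH[(n : ℝ) - 1] {x : EuclideanSpace ℝ (Fin n) | ‖x‖ = 1 ∧ g x < s} ≤
      4 ^ n / volume (ball (0 : EuclideanSpace ℝ (Fin n)) 1) *
        volume {y : EuclideanSpace ℝ (Fin n) | ‖y‖ ≤ 3 ∧ g y ≤ 3 * s} := by
  set A := {x : EuclideanSpace ℝ (Fin n) | ‖x‖ = 1 ∧ g x < s}
  set W := volume {y : EuclideanSpace ℝ (Fin n) | ‖y‖ ≤ 3 ∧ g y ≤ 3 * s}
  set ω := volume (ball (0 : EuclideanSpace ℝ (Fin n)) 1) with hω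
  have hω0 : ω ≠ 0 := (measure_ball_pos volume _ one_pos).ne'
  have hωt : ω ≠ ⊤ := measure_ball_lt_top.ne
  have hAtb : TotallyBounded A := by
    refine ((isCompact_closedBall (0 : EuclideanSpace ℝ (Fin n)) 1).totallyBounded).subset ?_
    intro x hx
    simpa using hx.1.le
  have hex : ∀ r : ℝ, ∃ C : Finset (EuclideanSpace ℝ (Fin n)), 0 < r →
      (∀ x ∈ C, x ∈ A) ∧ (∀ x ∈ C, ∀ y ∈ C, x ≠ y → r < dist x y) ∧
      A ⊆ ⋃ x ∈ C, closedBall x r := by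
    intro r
    by_cases hr : 0 < r
    · obtain ⟨C, hC⟩ := exists_finset_separated_cover hAtb hr
      exact ⟨C, fun _ => hC⟩
    · exact ⟨∅, fun h => absurd h hr⟩
  choose C hC using hex
  have hpos : ∀ᶠ r : ℝ in 𝓝[>] 0, 0 < r := eventually_mem_nhdsWithin
  have hle1 : ∀ᶠ r : ℝ in 𝓝[>] 0, r ≤ 1 :=
    nhdsWithin_le_nhds (eventually_le_nhds one_pos)
  have hBs : ∀ᶠ r : ℝ in 𝓝[>] 0, B * r ≤ 2 * s := by
    have : Tendsto (fun r : ℝ => B * r) (𝓝[>] 0) (𝓝 (B * 0)) :=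
      (continuous_const.mul continuous_id).continuousAt.tendsto.mono_left nhdsWithin_le_nhds
    rw [mul_zero] at this
    exact this.eventually_le_const (by positivity)
  have hdiam : ∀ r : ℝ, ∀ x : EuclideanSpace ℝ (Fin n),
      ediam (closedBall x r) ≤ ENNReal.ofReal (2 * r) := fun r x => by
    apply Metric.ediam_le_of_forall_dist_le
    intro y hy z hz
    have := dist_triangle_right y z x
    rw [mem_closedBall] at hy hz
    linarith
  have key := Measure.hausdorffMeasure_le_liminf_sum (ι := fun r : ℝ => {x // x ∈ C r})
    ((n : ℝ) - 1) A (l := 𝓝[>] (0 : ℝ)) (fun r => ENNReal.ofReal (2 * r))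
    (by
      have : Tendsto (fun r : ℝ => ENNReal.ofReal (2 * r)) (𝓝[>] 0)
          (𝓝 (ENNReal.ofReal (2 * 0))) :=
        (ENNReal.continuous_ofReal.comp
          (continuous_const.mul continuous_id)).continuousAt.tendsto.mono_left nhdsWithin_le_nhds
      simpa using this)
    (fun r x => closedBall (x : EuclideanSpace ℝ (Fin n)) r)
    (Eventually.of_forall fun r x => hdiam r x)
    (by
      filter_upwards [hpos] with r hr
      simpa [iUnion_subtype] using (hC r hr).2.2)
  refine key.trans (liminf_le_of_frequently_le' (Eventually.frequently ?_))
  filter_upwards [hpos, hle1, hBs] with r hr hr1 hrB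
  have hcard := card_separated_sphere_le hhom hlip hB hs hr hr1 hrB (C r) (hC r hr).1 (hC r hr).2.1
  rw [← mul_assoc, ← hω] at hcard
  have hcard' := (ENNReal.le_div_iff_mul_le (.inl hω0) (.inl hωt)).2 hcard
  have hn1 : (0 : ℝ) ≤ (n : ℝ) - 1 := by
    have : (1 : ℝ) ≤ n := by exact_mod_cast hn
    linarith
  calc ∑ i : {x // x ∈ C r}, ediam (closedBall (i : EuclideanSpace ℝ (Fin n)) r) ^ ((n : ℝ) - 1)
      ≤ ∑ i : {x // x ∈ C r}, ENNReal.ofReal (2 * r) ^ ((n : ℝ) - 1) := by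
        gcongr
        exact hdiam r _
    _ = (C r).card * ENNReal.ofReal ((2 * r) ^ (n - 1)) := by
        rw [Finset.sum_const, ENNReal.ofReal_rpow_of_nonneg (by positivity) hn1,
          ← Nat.cast_pred (by lia), Real.rpow_natCast]
        simp
    _ ≤ (C r).card * (4 ^ n * (ENNReal.ofReal r⁻¹ * ENNReal.ofReal ((r / 2) ^ n))) := by
        gcongr
        rw [← ENNReal.ofReal_mul (by positivity), ← ENNReal.ofReal_ofNat 4,
          ← ENNReal.ofReal_pow (by positivity), ← ENNReal.ofReal_mul (by positivity)]
        apply ENNReal.ofReal_le_ofReal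
        obtain ⟨k, rfl⟩ : ∃ k, n = k + 1 := ⟨n - 1, by lia⟩
        have h1 : (4 : ℝ) ^ (k + 1) * (r⁻¹ * (r / 2) ^ (k + 1)) = 2 * (4 * (r / 2)) ^ k := by
          rw [mul_pow, pow_succ, pow_succ]
          field_simp
          ring
        rw [h1, Nat.add_sub_cancel, show 4 * (r / 2) = 2 * r by ring]
        have : 0 ≤ (2 * r) ^ k := by positivity
        linarith
    _ = 4 ^ n * ((C r).card * ENNReal.ofReal r⁻¹ * ENNReal.ofReal ((r / 2) ^ n)) := by ring
    _ ≤ 4 ^ n * (W / ω) := by gcongr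
    _ = 4 ^ n / ω * W := by
        rw [div_eq_mul_inv, div_eq_mul_inv]
        ring


/-- The volume of a coordinate box in Euclidean space. -/
lemma volume_euclidean_box {n : ℕ} (c : Fin n → ℝ) :
    volume {y : EuclideanSpace ℝ (Fin n) | ∀ i, |y i| ≤ c i} = ∏ i, ENNReal.ofReal (2 * c i) := by
  have h : {y : EuclideanSpace ℝ (Fin n) | ∀ i, |y i| ≤ c i} =
      (WithLp.ofLp : EuclideanSpace ℝ (Fin n) → Fin n → ℝ) ⁻¹'
        (Set.pi univ fun i => Icc (-c i) (c i)) := by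
    ext y
    simp only [Set.mem_ofPred_eq, mem_preimage, mem_univ_pi, mem_Icc, abs_le]
  rw [h, (PiLp.volume_preserving_ofLp (Fin n)).measure_preimage
    (MeasurableSet.univ_pi fun i => measurableSet_Icc).nullMeasurableSet, volume_pi,
    Measure.pi_pi]
  simp [Real.volume_Icc, two_mul]

/-- The volume of the intersection of a ball with a slab. -/
lemma volume_slab_le {n : ℕ} (hn : 1 ≤ n) {u : EuclideanSpace ℝ (Fin n)} (hu : ‖u‖ = 1)
    (ρ δ : ℝ) :
    volume {y : EuclideanSpace ℝ (Fin n) | ‖y‖ ≤ ρ ∧ |⟪u, y⟫| ≤ δ} ≤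
      ENNReal.ofReal (2 * ρ) ^ (n - 1) * ENNReal.ofReal (2 * δ) := by
  classical
  let i₀ : Fin n := ⟨0, hn⟩
  have hon : Orthonormal ℝ (({i₀} : Set (Fin n)).domRestrict
      (fun _ : Fin n => u)) := by
    refine ⟨fun i => hu, fun i j hij => ?_⟩
    exact absurd (Subsingleton.elim i j) hij
  obtain ⟨b, hb⟩ := hon.exists_orthonormalBasis_extension_of_card_eq (by simp)
  have hb0 : b i₀ = u := hb i₀ rfl
  let c : Fin n → ℝ := Function.update (fun _ => ρ) i₀ δ
  have hsub : {y : EuclideanSpace ℝ (Fin n) | ‖y‖ ≤ ρ ∧ |⟪u, y⟫| ≤ δ} ⊆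
      b.repr ⁻¹' {y : EuclideanSpace ℝ (Fin n) | ∀ i, |y i| ≤ c i} := by
    rintro y ⟨hy1, hy2⟩ i
    rw [b.repr_apply_apply]
    by_cases hi : i = i₀
    · subst hi
      simpa [c, hb0] using hy2
    · have h1 := abs_real_inner_le_norm (b i) y
      rw [b.norm_eq_one, one_mul] at h1
      simpa [c, hi] using h1.trans hy1
  have hclosed : IsClosed {y : EuclideanSpace ℝ (Fin n) | ∀ i, |y i| ≤ c i} := by
    rw [Set.ofPred_forall]
    exact isClosed_iInter fun i => isClosed_le (by fun_prop) continuous_const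
  refine (measure_mono hsub).trans ?_
  rw [b.measurePreserving_repr.measure_preimage hclosed.measurableSet.nullMeasurableSet,
    volume_euclidean_box, ← Finset.prod_erase_mul _ _ (Finset.mem_univ i₀)]
  simp only [c, Function.update_self]
  rw [Finset.prod_congr rfl (g := fun _ => ENNReal.ofReal (2 * ρ)) fun i hi => by
    rw [Function.update_of_ne (Finset.ne_of_mem_erase hi)]]
  simp

lemma exists_closedBall_subset_of_symmetric {n : ℕ} {Ω : Set (EuclideanSpace ℝ (Fin n))}
    (hconv : Convex ℝ Ω) (hint : (interior Ω).Nonempty) (hsymm : Ω = -Ω) :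
    ∃ ε > 0, closedBall 0 ε ⊆ Ω := by
  obtain ⟨a, ha⟩ := hint
  obtain ⟨ε, hε, hball⟩ := Metric.isOpen_iff.1 isOpen_interior a ha
  refine ⟨ε / 3, by positivity, fun x hx => ?_⟩
  rw [mem_closedBall_zero_iff] at hx
  have h1 : a + (2 : ℝ) • x ∈ Ω := by
    apply interior_subset (hball _)
    rw [mem_ball, dist_eq_norm, add_sub_cancel_left, norm_smul, Real.norm_two]
    linarith
  have h2 : -a ∈ Ω := by
    rw [hsymm]
    simpa using interior_subset ha
  have := hconv h1 h2 (a := 1 / 2) (b := 1 / 2) (by norm_num) (by norm_num) (by norm_num)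
  convert this using 1
  module

lemma bddAbove_inner_image {n : ℕ} {Ω : Set (EuclideanSpace ℝ (Fin n))} (hΩ : IsCompact Ω)
    (x : EuclideanSpace ℝ (Fin n)) : BddAbove ((fun y => ⟪x, y⟫) '' Ω) :=
  (hΩ.image (by fun_prop)).bddAbove

lemma inner_le_suppFn {n : ℕ} {Ω : Set (EuclideanSpace ℝ (Fin n))} (hΩ : IsCompact Ω)
    (x : EuclideanSpace ℝ (Fin n)) {y : EuclideanSpace ℝ (Fin n)} (hy : y ∈ Ω) :
    ⟪x, y⟫ ≤ suppFn Ω x :=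
  le_csSup (bddAbove_inner_image hΩ x) (mem_image_of_mem _ hy)

lemma abs_inner_le_suppFn {n : ℕ} {Ω : Set (EuclideanSpace ℝ (Fin n))} (hΩ : IsCompact Ω)
    (hsymm : Ω = -Ω) (x : EuclideanSpace ℝ (Fin n)) {y : EuclideanSpace ℝ (Fin n)} (hy : y ∈ Ω) :
    |⟪x, y⟫| ≤ suppFn Ω x := by
  rw [abs_le']
  refine ⟨inner_le_suppFn hΩ x hy, ?_⟩
  rw [← inner_neg_right]
  apply inner_le_suppFn hΩ x
  rw [hsymm]
  simpa using hy

lemma suppFn_nonneg {n : ℕ} {Ω : Set (EuclideanSpace ℝ (Fin n))} (hΩ : IsCompact Ω)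
    (hne : Ω.Nonempty) (hsymm : Ω = -Ω) (x : EuclideanSpace ℝ (Fin n)) : 0 ≤ suppFn Ω x := by
  obtain ⟨y, hy⟩ := hne
  exact (abs_nonneg _).trans (abs_inner_le_suppFn hΩ hsymm x hy)

lemma exists_inner_eq_suppFn {n : ℕ} {Ω : Set (EuclideanSpace ℝ (Fin n))} (hΩ : IsCompact Ω)
    (hne : Ω.Nonempty) (x : EuclideanSpace ℝ (Fin n)) : ∃ y ∈ Ω, ⟪x, y⟫ = suppFn Ω x := by
  have h : IsCompact ((fun y => ⟪x, y⟫) '' Ω) := hΩ.image (by fun_prop)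
  exact h.sSup_mem (hne.image _)

lemma suppFn_smul {n : ℕ} (Ω : Set (EuclideanSpace ℝ (Fin n))) {t : ℝ} (ht : 0 ≤ t)
    (x : EuclideanSpace ℝ (Fin n)) : suppFn Ω (t • x) = t * suppFn Ω x := by
  unfold suppFn
  rw [← smul_eq_mul, ← Real.sSup_smul_of_nonneg ht, ← image_smul, image_image]
  simp_rw [real_inner_smul_left, smul_eq_mul]

lemma suppFn_le_add {n : ℕ} {Ω : Set (EuclideanSpace ℝ (Fin n))} (hΩ : IsCompact Ω)
    (hne : Ω.Nonempty) {B : ℝ} (hB : ∀ y ∈ Ω, ‖y‖ ≤ B) (x y : EuclideanSpace ℝ (Fin n)) :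
    suppFn Ω y ≤ suppFn Ω x + B * ‖y - x‖ := by
  obtain ⟨z, hz, hzy⟩ := exists_inner_eq_suppFn hΩ hne y
  have h1 : ⟪y, z⟫ = ⟪x, z⟫ + ⟪y - x, z⟫ := by rw [← inner_add_left, add_sub_cancel]
  have h2 := inner_le_suppFn hΩ x hz
  have h3 := real_inner_le_norm (y - x) z
  have h4 : ‖y - x‖ * ‖z‖ ≤ ‖y - x‖ * B := by gcongr; exact hB z hz
  rw [← hzy]
  linarith

/-- A weak form of the Blaschke–Santaló inequality. -/
lemma volume_suppFn_sublevel_mul_volume_le {n : ℕ} {Ω : Set (EuclideanSpace ℝ (Fin n))}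
    (hΩ : IsCompact Ω) (hconv : Convex ℝ Ω) (hint : (interior Ω).Nonempty) (hsymm : Ω = -Ω)
    {s : ℝ} (hs : 0 ≤ s) :
    volume {x | suppFn Ω x ≤ s} * volume Ω ≤ ENNReal.ofReal ((4 * s) ^ n) := by
  classical
  let M : (Fin n → EuclideanSpace ℝ (Fin n)) → Matrix (Fin n) (Fin n) ℝ :=
    fun y => Matrix.of fun i j => y j i
  have hMcont : Continuous fun y => |(M y).det| := by
    refine continuous_abs.comp (Continuous.matrix_det ?_)
    refine continuous_matrix fun i j => ?_
    simp only [M, Matrix.of_apply]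
    fun_prop
  have hne : Ω.Nonempty := hint.mono interior_subset
  obtain ⟨y, hy, hmax⟩ := (isCompact_univ_pi fun _ : Fin n => hΩ).exists_isMaxOn
    (univ_pi_nonempty_iff.2 fun _ => hne) hMcont.continuousOn
  have hyΩ : ∀ i, y i ∈ Ω := fun i => hy i (mem_univ i)
  obtain ⟨ε, hε, hball⟩ := exists_closedBall_subset_of_symmetric hconv hint hsymm
  have hdet : 0 < |(M y).det| := by
    let w : Fin n → EuclideanSpace ℝ (Fin n) := fun i => EuclideanSpace.single i ε
    have hw : w ∈ Set.pi univ fun _ : Fin n => Ω := fun i _ => by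
      apply hball
      simp [w, abs_of_pos hε]
    have hMw : M w = Matrix.diagonal fun _ => ε := by
      ext i j
      simp only [M, w, Matrix.of_apply, Matrix.diagonal_apply, PiLp.single_apply]
    refine lt_of_lt_of_le ?_ (hmax hw)
    simp only [hMw, Matrix.det_diagonal]
    simp [abs_of_pos hε, hε]
  have hdet0 : (M y).det ≠ 0 := abs_pos.1 hdet
  have hdetL : ∀ N : Matrix (Fin n) (Fin n) ℝ, LinearMap.det (Matrix.toEuclideanLin N) = N.det := by
    intro N
    have hN : Matrix.toEuclideanLin N =
        Matrix.toLin (PiLp.basisFun 2 ℝ (Fin n)) (PiLp.basisFun 2 ℝ (Fin n)) N :=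
      LinearEquiv.congr_fun (Matrix.toLpLin_eq_toLin 2 2) N
    rw [hN, LinearMap.det_toLin]
  have hsubΩ : Ω ⊆ Matrix.toEuclideanLin (M y) ''
      {x : EuclideanSpace ℝ (Fin n) | ∀ i, |x i| ≤ 1} := by
    intro z hz
    refine ⟨WithLp.toLp 2 ((M y).det⁻¹ • (M y).cramer z.ofLp), fun i => ?_, ?_⟩
    · have h1 : (M y).updateCol i z.ofLp = M (Function.update y i z) := by
        ext a b
        by_cases hb : b = i
        · subst hb
          simp [M]
        · simp [M, hb]
      have h2 : Function.update y i z ∈ Set.pi univ fun _ : Fin n => Ω := by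
        intro j _
        by_cases hj : j = i
        · subst hj
          simpa using hz
        · simpa [hj] using hyΩ j
      have h3 := hmax h2
      simp only [Set.mem_ofPred_eq] at h3
      simp only [Pi.smul_apply, Matrix.cramer_apply, h1, smul_eq_mul, abs_mul, abs_inv]
      rwa [inv_mul_le_iff₀ hdet, mul_one]
    · rw [Matrix.toLpLin_apply]
      simp [Matrix.mulVec_smul, Matrix.mulVec_cramer, smul_smul, inv_mul_cancel₀ hdet0]
  have hsubpolar : {x | suppFn Ω x ≤ s} ⊆ Matrix.toEuclideanLin (M y).transpose ⁻¹'
      {x : EuclideanSpace ℝ (Fin n) | ∀ i, |x i| ≤ s} := by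
    intro x hx i
    have h1 := (abs_inner_le_suppFn hΩ hsymm x (hyΩ i)).trans hx
    have h2 : (Matrix.toEuclideanLin (M y).transpose x) i = ⟪x, y i⟫ := by
      simp [Matrix.mulVec, dotProduct, M, PiLp.inner_apply]
    rw [h2]
    exact h1
  have hv1 : volume Ω ≤ ENNReal.ofReal |(M y).det| * 2 ^ n := by
    refine (measure_mono hsubΩ).trans_eq ?_
    rw [Measure.addHaar_image_linearMap, hdetL, volume_euclidean_box fun _ => 1]
    simp
  have hv2 : volume {x | suppFn Ω x ≤ s} ≤
      ENNReal.ofReal |(M y).det|⁻¹ * ENNReal.ofReal (2 * s) ^ n := by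
    refine (measure_mono hsubpolar).trans_eq ?_
    rw [Measure.addHaar_preimage_linearMap, hdetL, volume_euclidean_box fun _ => s, Matrix.det_transpose,
      abs_inv]
    · simp
    · rwa [hdetL, Matrix.det_transpose]
  calc volume {x | suppFn Ω x ≤ s} * volume Ω
      ≤ (ENNReal.ofReal |(M y).det|⁻¹ * ENNReal.ofReal (2 * s) ^ n) *
        (ENNReal.ofReal |(M y).det| * 2 ^ n) := by gcongr
    _ = ENNReal.ofReal ((4 * s) ^ n) := by
        rw [← ENNReal.ofReal_ofNat 2, ← ENNReal.ofReal_pow (by positivity),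
          ← ENNReal.ofReal_pow (by positivity), ← ENNReal.ofReal_mul (by positivity),
          ← ENNReal.ofReal_mul (by positivity), ← ENNReal.ofReal_mul (by positivity)]
        congr 1
        rw [mul_pow, mul_pow, show (4 : ℝ) = 2 * 2 by norm_num, mul_pow]
        field_simp

/-- A lower bound on the chord integral forces a lower bound on the volume. -/
lemma exists_volume_lower_bound {n : ℕ} (hn : 2 ≤ n) {q : ℝ} (hq1 : 1 < q) (hq2 : q < (n : ℝ) + 1)
    {c₀ : ℝ} (hc₀ : 0 < c₀) :
    ∃ V₀ : ℝ, 0 < V₀ ∧ ∀ Ω : Set (EuclideanSpace ℝ (Fin n)), IsCompact Ω →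
      c₀ ≤ chordIntegral n q Ω → V₀ ≤ volume.real Ω := by
  set k : ℝ := q * (q - 1) / ((n : ℝ) * unitBallVol n)
  have hk0 : 0 ≤ k := by
    have : 0 ≤ unitBallVol n := ENNReal.toReal_nonneg
    have : 0 ≤ q - 1 := by linarith
    positivity
  let φ : EuclideanSpace ℝ (Fin n) → ℝ := fun x => ‖x‖ ^ (q - 1 - (n : ℝ))
  have : Nontrivial (EuclideanSpace ℝ (Fin n)) :=
    Module.nontrivial_of_finrank_pos (R := ℝ) (by simp; lia)
  have hφint : IntegrableOn φ (ball 0 1) := by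
    rw [integrableOn_fun_norm_addHaar volume (f := fun t : ℝ => t ^ (q - 1 - (n : ℝ)))]
    have h : IntegrableOn (fun t : ℝ => t ^ (q - 2)) (Ioo 0 1) := by
      rw [intervalIntegral.integrableOn_Ioo_rpow_iff one_pos]
      linarith
    refine h.congr_fun (fun t ht => ?_) measurableSet_Ioo
    simp only [finrank_euclideanSpace_fin, smul_eq_mul]
    rw [← Real.rpow_natCast, ← Real.rpow_add ht.1, Nat.cast_pred (by lia)]
    congr 1
    ring
  set J : ℝ := ∫ x in ball (0 : EuclideanSpace ℝ (Fin n)) 1, φ x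
  have hφ0 : ∀ x, 0 ≤ φ x := fun x => by positivity
  have hJ0 : 0 ≤ J := setIntegral_nonneg measurableSet_ball fun x _ => hφ0 x
  have hinner : ∀ Ω : Set (EuclideanSpace ℝ (Fin n)), IsCompact Ω → ∀ z,
      ‖∫ y in Ω, ‖y - z‖ ^ (q - 1 - (n : ℝ))‖ ≤ J + volume.real Ω := by
    intro Ω hΩ z
    let ψ : EuclideanSpace ℝ (Fin n) → ℝ := (ball (0 : EuclideanSpace ℝ (Fin n)) 1).indicator φ
    have hψ : Integrable ψ := (integrable_indicator_iff measurableSet_ball).2 hφint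
    have hψ0 : ∀ x, 0 ≤ ψ x := fun x => indicator_nonneg (fun y _ => hφ0 y) x
    have hψz : Integrable fun y => ψ (y - z) := hψ.comp_sub_right z
    have hone : IntegrableOn (fun _ : EuclideanSpace ℝ (Fin n) => (1 : ℝ)) Ω :=
      integrableOn_const hΩ.measure_lt_top.ne
    rw [Real.norm_of_nonneg (integral_nonneg fun y => by positivity)]
    calc ∫ y in Ω, ‖y - z‖ ^ (q - 1 - (n : ℝ))
        ≤ ∫ y in Ω, (ψ (y - z) + 1) := by
          refine integral_mono_of_nonneg (Eventually.of_forall fun y => by positivity)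
            (hψz.integrableOn.add hone) (Eventually.of_forall fun y => ?_)
          by_cases hy : y - z ∈ ball (0 : EuclideanSpace ℝ (Fin n)) 1
          · simp only [ψ, indicator_of_mem hy, φ]
            linarith
          · simp only [ψ, indicator_of_notMem hy, zero_add]
            refine Real.rpow_le_one_of_one_le_of_nonpos ?_ (by linarith)
            simpa using hy
      _ = (∫ y in Ω, ψ (y - z)) + volume.real Ω := by
          rw [integral_add hψz.integrableOn hone]
          simp
      _ ≤ (∫ y, ψ (y - z)) + volume.real Ω := by
          exact add_le_add_left (setIntegral_le_integral hψz (Eventually.of_forall fun y => hψ0 _)) _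
      _ = J + volume.real Ω := by
          rw [integral_sub_right_eq_self ψ z, integral_indicator measurableSet_ball]
  have hI : ∀ Ω : Set (EuclideanSpace ℝ (Fin n)), IsCompact Ω →
      chordIntegral n q Ω ≤ k * ((J + volume.real Ω) * volume.real Ω) := by
    intro Ω hΩ
    unfold chordIntegral
    gcongr
    exact (Real.le_norm_self _).trans
      (norm_setIntegral_le_of_norm_le_const hΩ.measure_lt_top fun z _ => hinner Ω hΩ z)
  refine ⟨min 1 (c₀ / (k * (J + 1) + 1)), by positivity, fun Ω hΩ hc => ?_⟩
  by_contra! hlt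
  have hV0 : 0 ≤ volume.real Ω := measureReal_nonneg
  have h1 : volume.real Ω < 1 := hlt.trans_le (min_le_left _ _)
  have h2 := hlt.trans_le (min_le_right _ _)
  rw [lt_div_iff₀ (by positivity)] at h2
  have h3 : k * ((J + volume.real Ω) * volume.real Ω) ≤ k * ((J + 1) * volume.real Ω) := by
    gcongr
  have h4 := hc.trans (hI Ω hΩ)
  nlinarith

/-- The Hausdorff measure of the part of the sphere where the support function is small. -/
lemma hausdorffMeasure_suppFn_lt_le {n : ℕ} (hn : 1 ≤ n) {Ω : Set (EuclideanSpace ℝ (Fin n))}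
    (hΩ : IsCompact Ω) (hconv : Convex ℝ Ω) (hint : (interior Ω).Nonempty) (hsymm : Ω = -Ω)
    {V₀ : ℝ} (hV₀ : 0 < V₀) (hV : V₀ ≤ volume.real Ω) {u : EuclideanSpace ℝ (Fin n)}
    (hu : ‖u‖ = 1) (huR : 0 < suppFn Ω u) {s : ℝ} (hs : 0 < s) :
    μH[(n : ℝ) - 1] {x : EuclideanSpace ℝ (Fin n) | ‖x‖ = 1 ∧ suppFn Ω x < s} ≤
      4 ^ n / volume (ball (0 : EuclideanSpace ℝ (Fin n)) 1) *
        min (min (volume (closedBall (0 : EuclideanSpace ℝ (Fin n)) 3))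
          (ENNReal.ofReal (12 ^ n / V₀) * ENNReal.ofReal (s ^ n)))
          (6 ^ n * ENNReal.ofReal (s / suppFn Ω u)) := by
  have hne : Ω.Nonempty := hint.mono interior_subset
  obtain ⟨B, hB0, hB⟩ := hΩ.isBounded.exists_pos_norm_le
  refine (hausdorffMeasure_sphere_sublevel_le hn (fun t ht x => suppFn_smul Ω ht x)
    (suppFn_le_add hΩ hne hB) hB0.le hs).trans ?_
  gcongr
  refine le_min (le_min ?_ ?_) ?_
  · refine measure_mono fun y hy => ?_
    simpa using hy.1
  · have h1 := volume_suppFn_sublevel_mul_volume_le hΩ hconv hint hsymm (s := 3 * s) (by positivity)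
    have h2 : ENNReal.ofReal V₀ ≤ volume Ω :=
      (ENNReal.ofReal_le_ofReal hV).trans_eq (ENNReal.ofReal_toReal hΩ.measure_lt_top.ne)
    have h3 : volume {x | suppFn Ω x ≤ 3 * s} * ENNReal.ofReal V₀ ≤
        ENNReal.ofReal ((4 * (3 * s)) ^ n) := le_trans (by gcongr) h1
    rw [← ENNReal.le_div_iff_mul_le (.inl (by simpa using hV₀)) (.inl ENNReal.ofReal_ne_top),
      ← ENNReal.ofReal_div_of_pos hV₀] at h3
    refine (measure_mono fun y hy => hy.2).trans (h3.trans_eq ?_)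
    rw [← ENNReal.ofReal_mul (by positivity)]
    congr 1
    rw [← mul_assoc, mul_pow]
    norm_num
    ring
  · obtain ⟨y, hy, hyu⟩ := exists_inner_eq_suppFn hΩ hne u
    have hyn : suppFn Ω u ≤ ‖y‖ := by
      have := real_inner_le_norm u y
      rwa [hyu, hu, one_mul] at this
    have hy0 : 0 < ‖y‖ := huR.trans_le hyn
    have hv : ‖‖y‖⁻¹ • y‖ = 1 := by
      rw [norm_smul, norm_inv, norm_norm, inv_mul_cancel₀ hy0.ne']
    have hsub : {x : EuclideanSpace ℝ (Fin n) | ‖x‖ ≤ 3 ∧ suppFn Ω x ≤ 3 * s} ⊆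
        {x | ‖x‖ ≤ 3 ∧ |⟪‖y‖⁻¹ • y, x⟫| ≤ 3 * (s / suppFn Ω u)} := by
      rintro x ⟨hx1, hx2⟩
      refine ⟨hx1, ?_⟩
      rw [real_inner_smul_left, abs_mul, abs_of_pos (inv_pos.2 hy0), real_inner_comm]
      calc ‖y‖⁻¹ * |⟪x, y⟫| ≤ (suppFn Ω u)⁻¹ * (3 * s) := by
            gcongr
            exact (abs_inner_le_suppFn hΩ hsymm x hy).trans hx2
        _ = 3 * (s / suppFn Ω u) := by ring
    refine (measure_mono hsub).trans ((volume_slab_le hn hv _ _).trans_eq ?_)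
    obtain ⟨k, rfl⟩ : ∃ k, n = k + 1 := ⟨n - 1, by lia⟩
    rw [Nat.add_sub_cancel, ← mul_assoc 2 3, ENNReal.ofReal_mul (p := 2 * 3) (by norm_num),
      pow_succ, mul_assoc]
    norm_num

lemma tendsto_lintegral_min_rpow {n : ℕ} {p : ℝ} (hp1 : -(n : ℝ) < p) (hp2 : p < 0)
    {a b c : ℝ≥0∞} (ha : a ≠ ⊤) (hb : b ≠ ⊤) (hc : c ≠ ⊤) :
    Tendsto (fun R : ℝ => ∫⁻ t in Ioi (0 : ℝ),
      min (min a (b * ENNReal.ofReal ((t ^ p⁻¹) ^ n))) (c * ENNReal.ofReal (t ^ p⁻¹ / R)))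
      atTop (𝓝 0) := by
  have h0 : (0 : ℝ≥0∞) = ∫⁻ t in Ioi (0 : ℝ), 0 := by simp
  rw [h0]
  refine tendsto_lintegral_filter_of_dominated_convergence
    (fun t => min a (b * ENNReal.ofReal ((t ^ p⁻¹) ^ n)))
    (Eventually.of_forall fun R => by fun_prop)
    (Eventually.of_forall fun R => Eventually.of_forall fun t => min_le_left _ _) ?_ ?_
  · have hexp : (n : ℝ) * p⁻¹ < -1 := by
      rw [← div_eq_mul_inv, div_lt_iff_of_neg hp2]
      linarith
    have hint : IntegrableOn (fun t : ℝ => t ^ (p⁻¹ * n)) (Ioi 1) :=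
      integrableOn_Ioi_rpow_of_lt (by linarith) one_pos
    rw [← Ioc_union_Ioi_eq_Ioi (zero_le_one (α := ℝ))]
    refine ((lintegral_union_le _ _ _).trans_lt (ENNReal.add_lt_top.2 ⟨?_, ?_⟩)).ne
    · refine (lintegral_mono fun t => min_le_left _ _).trans_lt ?_
      simpa using ha.lt_top
    · refine (lintegral_mono fun t => min_le_right _ _).trans_lt ?_
      rw [lintegral_const_mul' _ _ hb]
      refine ENNReal.mul_lt_top hb.lt_top ?_
      have := hint.lintegral_lt_top
      refine lt_of_le_of_lt (le_of_eq ?_) this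
      refine setLIntegral_congr_fun measurableSet_Ioi fun t ht => ?_
      have ht0 : (0 : ℝ) ≤ t := zero_le_one.trans (le_of_lt ht)
      rw [← Real.rpow_natCast, ← Real.rpow_mul ht0]
  · refine Eventually.of_forall fun t => ?_
    have h1 : Tendsto (fun R : ℝ => c * ENNReal.ofReal (t ^ p⁻¹ / R)) atTop (𝓝 0) := by
      have h2 : Tendsto (fun R : ℝ => t ^ p⁻¹ / R) atTop (𝓝 0) :=
        tendsto_const_nhds.div_atTop tendsto_id
      have h3 := ENNReal.Tendsto.const_mul (a := c) (ENNReal.tendsto_ofReal h2) (.inr hc)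
      simpa using h3
    exact tendsto_of_tendsto_of_tendsto_of_le_of_le tendsto_const_nhds h1
      (fun _ => zero_le) fun _ => min_le_right _ _

/-- The layer-cake bound for the integral of a negative power of the support function. -/
lemma lintegral_suppFn_rpow_le {n : ℕ} (hn : 1 ≤ n) {p : ℝ} (hp : p < 0)
    {Ω : Set (EuclideanSpace ℝ (Fin n))}
    (hΩ : IsCompact Ω) (hconv : Convex ℝ Ω) (hint : (interior Ω).Nonempty) (hsymm : Ω = -Ω)
    {V₀ : ℝ} (hV₀ : 0 < V₀) (hV : V₀ ≤ volume.real Ω) {u : EuclideanSpace ℝ (Fin n)}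
    (hu : ‖u‖ = 1) (huR : 0 < suppFn Ω u) :
    ∫⁻ x in sphere (0 : EuclideanSpace ℝ (Fin n)) 1,
        ENNReal.ofReal (suppFn Ω x ^ p) ∂(μH[(n : ℝ) - 1]) ≤
      4 ^ n / volume (ball (0 : EuclideanSpace ℝ (Fin n)) 1) * ∫⁻ t in Ioi (0 : ℝ),
        min (min (volume (closedBall (0 : EuclideanSpace ℝ (Fin n)) 3))
          (ENNReal.ofReal (12 ^ n / V₀) * ENNReal.ofReal ((t ^ p⁻¹) ^ n)))
          (6 ^ n * ENNReal.ofReal (t ^ p⁻¹ / suppFn Ω u)) := by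
  have hne : Ω.Nonempty := hint.mono interior_subset
  obtain ⟨B, hB0, hB⟩ := hΩ.isBounded.exists_pos_norm_le
  have hpos : ∀ x, 0 ≤ suppFn Ω x := suppFn_nonneg hΩ hne hsymm
  have hcont : Continuous (suppFn Ω) := by
    refine (LipschitzWith.of_le_add_mul (K := B.toNNReal) fun x y => ?_).continuous
    rw [Real.coe_toNNReal _ hB0.le, dist_eq_norm]
    exact suppFn_le_add hΩ hne hB y x
  have hω0 : volume (ball (0 : EuclideanSpace ℝ (Fin n)) 1) ≠ 0 :=
    (measure_ball_pos volume _ one_pos).ne'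
  rw [lintegral_eq_lintegral_meas_lt _ (Eventually.of_forall fun x => Real.rpow_nonneg (hpos x) p)
    (hcont.measurable.pow_const p).aemeasurable,
    ← lintegral_const_mul' _ _ (ENNReal.div_ne_top (by simp) hω0)]
  refine setLIntegral_mono' measurableSet_Ioi fun t ht => ?_
  have ht0 : (0 : ℝ) < t := ht
  rw [Measure.restrict_apply' isClosed_sphere.measurableSet]
  refine le_trans (measure_mono ?_) (hausdorffMeasure_suppFn_lt_le hn hΩ hconv hint hsymm hV₀ hV
    hu huR (Real.rpow_pos_of_pos ht0 p⁻¹))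
  rintro x ⟨hx1, hx2⟩
  refine ⟨by simpa using hx2, ?_⟩
  rcases (hpos x).eq_or_lt with h | h
  · rw [← h]
    exact Real.rpow_pos_of_pos ht0 _
  · exact (Real.lt_rpow_inv_iff_of_neg h ht0 hp).2 hx1

end

theorem stmt_3 {n : ℕ} (hn : 2 ≤ n) (p q : ℝ) (hp1 : -(n : ℝ) < p) (hp2 : p < 0)
    (hq1 : 1 < q) (hq2 : q < (n : ℝ) + 1)
    (f : EuclideanSpace ℝ (Fin n) → ℝ)
    (hf_cont : ContinuousOn f (sphere (0 : EuclideanSpace ℝ (Fin n)) 1))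
    (hf_pos : ∀ x ∈ sphere (0 : EuclideanSpace ℝ (Fin n)) 1, 0 < f x)
    (hf_even : ∀ x : EuclideanSpace ℝ (Fin n), f (-x) = f x)
    (c₀ Cstar : ℝ) (hc₀ : 0 < c₀) (hCstar : 0 < Cstar) :
    ∃ C : ℝ, 1 ≤ C ∧
      ∀ Ω : Set (EuclideanSpace ℝ (Fin n)),
        IsCompact Ω → Convex ℝ Ω → (interior Ω).Nonempty → Ω = -Ω →
        c₀ ≤ chordIntegral n q Ω →
        Cstar ≤ (∫ x in sphere (0 : EuclideanSpace ℝ (Fin n)) 1,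
            f x * suppFn Ω x ^ p ∂(μH[(n : ℝ) - 1])) →
        ∀ x ∈ sphere (0 : EuclideanSpace ℝ (Fin n)) 1,
          1 / C ≤ suppFn Ω x ∧ suppFn Ω x ≤ C := by
  obtain ⟨V₀, hV₀, hV⟩ := exists_volume_lower_bound hn hq1 hq2 hc₀
  obtain ⟨F, hF⟩ := (isCompact_sphere (0 : EuclideanSpace ℝ (Fin n)) 1).exists_bound_of_continuousOn
    hf_cont
  have hn1 : 1 ≤ n := by lia
  have hω0 : volume (ball (0 : EuclideanSpace ℝ (Fin n)) 1) ≠ 0 :=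
    (measure_ball_pos volume _ one_pos).ne'
  have hlim := ENNReal.Tendsto.const_mul (a := ENNReal.ofReal F *
      (4 ^ n / volume (ball (0 : EuclideanSpace ℝ (Fin n)) 1)))
    (tendsto_lintegral_min_rpow hp1 hp2
      (a := volume (closedBall (0 : EuclideanSpace ℝ (Fin n)) 3))
      (b := ENNReal.ofReal (12 ^ n / V₀)) (c := 6 ^ n) measure_closedBall_lt_top.ne
      ENNReal.ofReal_ne_top (by simp))
    (.inr (ENNReal.mul_ne_top ENNReal.ofReal_ne_top (ENNReal.div_ne_top (by simp) hω0)))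
  rw [mul_zero] at hlim
  obtain ⟨R₀, hR₀'⟩ := Filter.eventually_atTop.1 ((hlim.eventually_lt_const
    (ENNReal.ofReal_pos.2 hCstar)).and (Filter.eventually_ge_atTop 1))
  have hR₀1 : 1 ≤ R₀ := (hR₀' R₀ le_rfl).2
  have hδ : 0 < (2 * R₀) ^ (n - 1) * 2 / V₀ := by positivity
  refine ⟨R₀ + (2 * R₀) ^ (n - 1) * 2 / V₀, by linarith, ?_⟩
  intro Ω hΩ hconv hint hsymm hI hfh
  have hne : Ω.Nonempty := hint.mono interior_subset
  have hupper : ∀ x ∈ sphere (0 : EuclideanSpace ℝ (Fin n)) 1, suppFn Ω x ≤ R₀ := by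
    intro u hu
    by_contra! hlt
    have hbound := lintegral_suppFn_rpow_le hn1 hp2 hΩ hconv hint hsymm hV₀ (hV Ω hΩ hI)
      (u := u) (by simpa using hu) (by linarith)
    refine (hR₀' _ hlt.le).1.not_ge ?_
    calc ENNReal.ofReal Cstar
        ≤ ENNReal.ofReal (∫ x in sphere (0 : EuclideanSpace ℝ (Fin n)) 1,
            f x * suppFn Ω x ^ p ∂(μH[(n : ℝ) - 1])) := ENNReal.ofReal_le_ofReal hfh
      _ ≤ ‖∫ x in sphere (0 : EuclideanSpace ℝ (Fin n)) 1,
            f x * suppFn Ω x ^ p ∂(μH[(n : ℝ) - 1])‖ₑ := Real.ofReal_le_enorm _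
      _ ≤ ∫⁻ x in sphere (0 : EuclideanSpace ℝ (Fin n)) 1,
            ‖f x * suppFn Ω x ^ p‖ₑ ∂(μH[(n : ℝ) - 1]) := enorm_integral_le_lintegral_enorm _
      _ ≤ ∫⁻ x in sphere (0 : EuclideanSpace ℝ (Fin n)) 1,
            ENNReal.ofReal F * ENNReal.ofReal (suppFn Ω x ^ p) ∂(μH[(n : ℝ) - 1]) := by
          refine setLIntegral_mono' isClosed_sphere.measurableSet fun x hx => ?_
          have hx0 : 0 ≤ suppFn Ω x := suppFn_nonneg hΩ hne hsymm x
          rw [enorm_mul, Real.enorm_of_nonneg (Real.rpow_nonneg hx0 p)]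
          gcongr
          rw [← ofReal_norm]
          exact ENNReal.ofReal_le_ofReal (hF x hx)
      _ ≤ _ := by
          rw [lintegral_const_mul' _ _ ENNReal.ofReal_ne_top, mul_assoc]
          gcongr
  have hnorm : ∀ y ∈ Ω, ‖y‖ ≤ R₀ := by
    intro y hy
    rcases eq_or_ne y 0 with rfl | hy0
    · rw [norm_zero]
      linarith
    · have hyn : 0 < ‖y‖ := norm_pos_iff.2 hy0
      have h1 := inner_le_suppFn hΩ (‖y‖⁻¹ • y) hy
      rw [real_inner_smul_left, real_inner_self_eq_norm_mul_norm, inv_mul_cancel_left₀ hyn.ne'] at h1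
      exact h1.trans (hupper _ (by simp [norm_smul, hyn.ne']))
  intro x hx
  have hx1 : ‖x‖ = 1 := by simpa using hx
  refine ⟨?_, (hupper x hx).trans (by linarith)⟩
  have hx0 : 0 ≤ suppFn Ω x := suppFn_nonneg hΩ hne hsymm x
  have hvol : volume Ω ≤ ENNReal.ofReal ((2 * R₀) ^ (n - 1) * (2 * suppFn Ω x)) := by
    rw [ENNReal.ofReal_mul (by positivity), ENNReal.ofReal_pow (by positivity)]
    refine le_trans (measure_mono ?_) (volume_slab_le hn1 hx1 R₀ (suppFn Ω x))
    exact fun y hy => ⟨hnorm y hy, abs_inner_le_suppFn hΩ hsymm x hy⟩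
  have hV' : V₀ ≤ (2 * R₀) ^ (n - 1) * (2 * suppFn Ω x) :=
    (hV Ω hΩ hI).trans (ENNReal.toReal_le_of_le_ofReal (by positivity) hvol)
  calc 1 / (R₀ + (2 * R₀) ^ (n - 1) * 2 / V₀) ≤ 1 / ((2 * R₀) ^ (n - 1) * 2 / V₀) := by
        apply one_div_le_one_div_of_le hδ
        linarith
    _ = V₀ / ((2 * R₀) ^ (n - 1) * 2) := one_div_div _ _
    _ ≤ suppFn Ω x := by
        rw [div_le_iff₀ (by positivity)]
        linarith
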